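/- Let G be a connected graph, K ⊆ V(G) a finite set of vertices, and suppose G − K has at least two connected components each of which is transient for simple random walk. Then G admits a nonconstant bounded harmonic Dirichlet function. -/

import Mathlib

/-- A (locally finite connected) graph is transient for simple random walk iff it admits
a unit flow of finite energy from some vertex to infinity (T. Lyons' criterion):
`θ` is antisymmetric, supported on edges, has divergence `0` at every vertex except the
source `o`, where the divergence is `1`, and has finite energy `Σ θ(e)² < ∞`. -/
def IsTransient {V : Type*} (G : SimpleGraph V) : Prop :=
  ∃ o : V, ∃ θ : V → V → ℝ,
    (∀ x y, θ x y = -θ y x) ∧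
    (∀ x y, ¬ G.Adj x y → θ x y = 0) ∧
    (∀ x, x ≠ o → ∑' y : V, θ x y = 0) ∧
    (∑' y : V, θ o y = 1) ∧
    Summable (fun p : V × V => (θ p.1 p.2) ^ 2)

/-- `F` is harmonic on `G`: at every vertex, `deg(x) · F(x)` equals the sum of `F` over
the neighbors of `x`. -/
def IsHarmonic {V : Type*} (G : SimpleGraph V) (F : V → ℝ) : Prop :=
  ∀ x : V, ((G.neighborSet x).ncard : ℝ) * F x = ∑' y : G.neighborSet x, F (y : V)

/-- `F` is Dirichlet on `G`: the energy `Σ_{x∼y} (F(x) − F(y))²` is finite. -/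
def IsDirichlet {V : Type*} (G : SimpleGraph V) (F : V → ℝ) : Prop :=
  Summable (fun p : {p : V × V // G.Adj p.1 p.2} => (F (p : V × V).1 - F (p : V × V).2) ^ 2)

/-- A function on `V` pointwise bounded by `0` and `1`, agreeing with `u` off `S`, which is
minimal for the energy carried by the finite edge set spanned by `T`. -/
theorem exists_energy_minimizer {V : Type*} (c : V → V → ℝ) (S T : Finset V) (u : V → ℝ)
    (hu : ∀ x, u x ∈ Set.Icc (0 : ℝ) 1) :
    ∃ f : V → ℝ, (∀ x, f x ∈ Set.Icc (0 : ℝ) 1) ∧ (∀ x, x ∉ S → f x = u x) ∧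
      ∀ g : V → ℝ, (∀ x, g x ∈ Set.Icc (0 : ℝ) 1) → (∀ x, x ∉ S → g x = u x) →
        ∑ x ∈ T, ∑ y ∈ T, c x y * (f x - f y) ^ 2 ≤
          ∑ x ∈ T, ∑ y ∈ T, c x y * (g x - g y) ^ 2 := by
  have hcomp : IsCompact (Set.univ.pi fun _ : V => Set.Icc (0 : ℝ) 1) :=
    isCompact_univ_pi fun _ => isCompact_Icc
  have hclosed : IsClosed {f : V → ℝ | ∀ x, x ∉ S → f x = u x} := by
    simp only [Set.ofPred_forall]
    exact isClosed_iInter fun x => isClosed_iInter fun _ =>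
      isClosed_eq (continuous_apply x) continuous_const
  obtain ⟨f, ⟨hf, hfS⟩, hmin⟩ := (hcomp.inter_right hclosed).exists_isMinOn
    ⟨u, fun x _ => hu x, fun _ _ => rfl⟩
    (f := fun f : V → ℝ => ∑ x ∈ T, ∑ y ∈ T, c x y * (f x - f y) ^ 2)
    (by fun_prop)
  exact ⟨f, fun x => hf x trivial, hfS, fun g hg hgS => hmin ⟨fun x _ => hg x, hgS⟩⟩

/-- Summation by parts for an antisymmetric kernel. -/
theorem sum_antisymm_mul_sub {V : Type*} (θ : V → V → ℝ) (hθ : ∀ x y, θ x y = -θ y x)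
    (T : Finset V) (g : V → ℝ) :
    ∑ x ∈ T, ∑ y ∈ T, θ x y * (g x - g y) = 2 * ∑ x ∈ T, g x * ∑ y ∈ T, θ x y := by
  have h1 : ∑ x ∈ T, ∑ y ∈ T, θ x y * g y = -∑ x ∈ T, ∑ y ∈ T, θ x y * g x := by
    rw [Finset.sum_comm, ← Finset.sum_neg_distrib]
    refine Finset.sum_congr rfl fun x _ => ?_
    rw [← Finset.sum_neg_distrib]
    exact Finset.sum_congr rfl fun y _ => by rw [hθ y x]; ring
  simp only [mul_sub, Finset.sum_sub_distrib, h1, Finset.mul_sum]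
  rw [sub_neg_eq_add, ← two_mul, Finset.mul_sum]
  refine Finset.sum_congr rfl fun x _ => ?_
  rw [Finset.mul_sum]
  exact Finset.sum_congr rfl fun y _ => by ring

open Classical in
/-- An energy minimizer with values in `[0, 1]` is harmonic at the vertices where it is free. -/
theorem laplacian_eq_zero_of_minimal {V : Type*} (c : V → V → ℝ) (hc : ∀ x y, c x y = c y x)
    (hc0 : ∀ x y, 0 ≤ c x y) (hcd : ∀ x, c x x = 0) (T : Finset V) (f : V → ℝ)
    (hf : ∀ x, f x ∈ Set.Icc (0 : ℝ) 1) (z : V) (hz : z ∈ T)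
    (hmin : ∀ a ∈ Set.Icc (0 : ℝ) 1, ∑ x ∈ T, ∑ y ∈ T, c x y * (f x - f y) ^ 2 ≤
      ∑ x ∈ T, ∑ y ∈ T, c x y * (Function.update f z a x - Function.update f z a y) ^ 2) :
    ∑ y ∈ T, c z y * (f z - f y) = 0 := by
  set d := ∑ y ∈ T, c z y with hd
  set L := ∑ y ∈ T, c z y * (f z - f y) with hL
  have hd0 : 0 ≤ d := Finset.sum_nonneg fun y _ => hc0 z y
  rcases hd0.eq_or_lt with h0 | hpos
  · have h := (Finset.sum_eq_zero_iff_of_nonneg fun y _ => hc0 z y).1 h0.symm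
    exact Finset.sum_eq_zero fun y hy => by rw [h y hy, zero_mul]
  have hLd : L = d * f z - ∑ y ∈ T, c z y * f y := by
    rw [hL, hd, Finset.sum_mul, ← Finset.sum_sub_distrib]
    exact Finset.sum_congr rfl fun y _ => by ring
  have hs0 : 0 ≤ ∑ y ∈ T, c z y * f y :=
    Finset.sum_nonneg fun y _ => mul_nonneg (hc0 z y) (hf y).1
  have hs1 : ∑ y ∈ T, c z y * f y ≤ d :=
    Finset.sum_le_sum fun y _ => mul_le_of_le_one_right (hc0 z y) (hf y).2
  set δ : V → ℝ := Pi.single z 1 with hδ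
  set t := -L / d with ht
  have htd : t * d = -L := by rw [ht]; field_simp
  have ha : f z + t ∈ Set.Icc (0 : ℝ) 1 := by
    have e : f z + t = (∑ y ∈ T, c z y * f y) / d := by
      rw [ht, hLd]; field_simp; ring
    rw [e]
    exact ⟨div_nonneg hs0 hd0, div_le_one_of_le₀ hs1 hd0⟩
  have hup : ∀ x, Function.update f z (f z + t) x = f x + t * δ x := by
    intro x
    by_cases hx : x = z
    · subst hx; simp [hδ]
    · simp [hδ, hx]
  have h1 : ∑ x ∈ T, ∑ y ∈ T, c x y * (f x - f y) * (δ x - δ y) = 2 * L := by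
    rw [sum_antisymm_mul_sub (fun x y => c x y * (f x - f y))
      (fun x y => by rw [hc x y]; ring), Finset.sum_eq_single_of_mem z hz]
    · simp [hδ, hL]
    · intro x _ hx; simp [hδ, hx]
  have h2 : ∑ x ∈ T, ∑ y ∈ T, c x y * (δ x - δ y) * (δ x - δ y) = 2 * d := by
    rw [sum_antisymm_mul_sub (fun x y => c x y * (δ x - δ y))
      (fun x y => by rw [hc x y]; ring), Finset.sum_eq_single_of_mem z hz]
    · rw [hδ, Pi.single_eq_same, one_mul, hd]
      congr 1
      refine Finset.sum_congr rfl fun y _ => ?_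
      by_cases hy : y = z
      · subst hy; simp [hcd]
      · simp [hy]
    · intro x _ hx; simp [hδ, hx]
  have h3 := hmin _ ha
  simp only [hup] at h3
  have h4 : ∑ x ∈ T, ∑ y ∈ T, c x y * (f x + t * δ x - (f y + t * δ y)) ^ 2 =
      ∑ x ∈ T, ∑ y ∈ T, c x y * (f x - f y) ^ 2 + 2 * t * (2 * L) + t ^ 2 * (2 * d) := by
    rw [← h1, ← h2]
    simp only [Finset.mul_sum, ← Finset.sum_add_distrib]
    exact Finset.sum_congr rfl fun x _ => Finset.sum_congr rfl fun y _ => by ring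
  rw [h4] at h3
  have h5 : t * L ≥ 0 := by nlinarith [congrArg (t * ·) htd]
  have h6 : L ^ 2 ≤ 0 := by nlinarith [congrArg (L * ·) htd]
  exact pow_eq_zero_iff two_ne_zero |>.1 (le_antisymm h6 (sq_nonneg L))

open Classical in
/-- A unit flow on an induced subgraph extends by zero to the ambient graph. -/
theorem IsTransient.exists_flow_of_induce {V : Type*} {G : SimpleGraph V}
    (hlf : ∀ v : V, (G.neighborSet v).Finite) {A : Set V} (h : IsTransient (G.induce A)) :
    ∃ o ∈ A, ∃ θ : V → V → ℝ, (∀ x y, θ x y = -θ y x) ∧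
      (∀ x y, θ x y ≠ 0 → G.Adj x y ∧ x ∈ A ∧ y ∈ A) ∧
      (∀ x, ∑ y ∈ (hlf x).toFinset, θ x y = if x = o then 1 else 0) ∧
      Summable fun p : V × V => θ p.1 p.2 ^ 2 := by
  obtain ⟨o, θ, hanti, hsupp, hdiv, hone, hsum⟩ := h
  set η : V → V → ℝ := fun x y =>
    if h : x ∈ A ∧ y ∈ A then θ ⟨x, h.1⟩ ⟨y, h.2⟩ else 0 with hη
  have hηA : ∀ x y : A, η x y = θ x y := fun x y => by simp [hη]
  have hηsupp : ∀ x y, η x y ≠ 0 → G.Adj x y ∧ x ∈ A ∧ y ∈ A := by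
    intro x y hxy
    by_cases h : x ∈ A ∧ y ∈ A
    · refine ⟨?_, h⟩
      by_contra hadj
      exact hxy (by simp only [hη, dif_pos h]; exact hsupp _ _ (by simpa using hadj))
    · exact absurd (dif_neg h) hxy
  refine ⟨o, o.2, η, ?_, hηsupp, ?_, ?_⟩
  · intro x y
    by_cases h : x ∈ A ∧ y ∈ A
    · simp only [hη, dif_pos h, dif_pos h.symm]; exact hanti _ _
    · simp only [hη, dif_neg h, dif_neg fun h' => h (And.symm h'), neg_zero]
  · intro x
    have e : ∑ y ∈ (hlf x).toFinset, η x y = ∑' y, η x y := by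
      refine (tsum_eq_sum fun y hy => ?_).symm
      by_contra hne
      exact hy (by simpa using (hηsupp x y hne).1)
    rw [e]
    by_cases hx : x ∈ A
    · have e2 : ∑' y, η x y = ∑' y : A, θ ⟨x, hx⟩ y := by
        rw [← tsum_subtype_eq_of_support_subset (s := A)
          fun y hy => (hηsupp x y hy).2.2]
        exact tsum_congr fun y => hηA ⟨x, hx⟩ y
      rw [e2]
      split_ifs with hxo
      · subst hxo; exact hone
      · exact hdiv _ fun h => hxo (congrArg Subtype.val h)
    · have hxo : x ≠ o := fun h => hx (h ▸ o.2)
      simp [hη, hx, hxo]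
  · have hinj : Function.Injective (Prod.map Subtype.val Subtype.val : A × A → V × V) :=
      Subtype.val_injective.prodMap Subtype.val_injective
    rw [← hinj.summable_iff]
    · refine hsum.congr fun p => ?_
      simp [hηA]
    · rintro ⟨x, y⟩ hxy
      by_contra hne
      have h := hηsupp x y fun h => hne (by simp [h])
      exact hxy ⟨(⟨x, h.2.1⟩, ⟨y, h.2.2⟩), rfl⟩

open Filter Topology in
/-- Along a family of functions of bounded energy converging to a constant, the pairing of
gradients with a kernel of finite energy tends to zero: if these pairings converge, the limit is
zero. -/
theorem pairing_limit_eq_zero {V ι : Type*} {l : Filter ι} [l.NeBot] (P : ι → Finset (V × V))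
    (hP : ∀ E : Finset (V × V), ∀ᶠ i in l, E ⊆ P i) (θ : V × V → ℝ)
    (hθ : Summable fun p => θ p ^ 2) (df : ι → V × V → ℝ)
    (hdf : ∀ p, Tendsto (fun i => df i p) l (𝓝 0)) (D : ℝ)
    (hD : ∀ i, ∑ p ∈ P i with θ p ≠ 0, df i p ^ 2 ≤ D) (a : ℝ)
    (ha : Tendsto (fun i => ∑ p ∈ P i, θ p * df i p) l (𝓝 a)) : a = 0 := by
  classical
  obtain ⟨i₀⟩ : Nonempty ι := l.nonempty_of_neBot
  have hD0 : 0 ≤ D := (Finset.sum_nonneg fun p _ => sq_nonneg _).trans (hD i₀)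
  have key : ∀ ε > 0, a ^ 2 ≤ ε * D := by
    intro ε hε
    obtain ⟨E, hE⟩ := summable_iff_vanishing_norm.1 hθ ε hε
    have h1 : Tendsto (fun i => ∑ p ∈ E, θ p * df i p) l (𝓝 0) := by
      simpa using tendsto_finsetSum E fun p _ => (hdf p).const_mul (θ p)
    have h2 := (ha.sub h1).pow 2
    rw [sub_zero] at h2
    refine le_of_tendsto h2 ?_
    filter_upwards [hP E] with i hi
    rw [← Finset.sum_sdiff hi, add_sub_cancel_right]
    have e : ∑ p ∈ P i \ E, θ p * df i p = ∑ p ∈ P i \ E with θ p ≠ 0, θ p * df i p := by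
      rw [Finset.sum_filter]
      exact Finset.sum_congr rfl fun p _ => by by_cases h : θ p = 0 <;> simp [h]
    rw [e]
    refine (Finset.sum_mul_sq_le_sq_mul_sq _ _ _).trans ?_
    have h3 : ∑ p ∈ P i \ E with θ p ≠ 0, θ p ^ 2 ≤ ε :=
      (le_abs_self _).trans (hE _ (Finset.disjoint_of_subset_left (Finset.filter_subset _ _)
        Finset.sdiff_disjoint)).le
    have h4 : ∑ p ∈ P i \ E with θ p ≠ 0, df i p ^ 2 ≤ D :=
      (Finset.sum_le_sum_of_subset_of_nonneg (Finset.filter_subset_filter _ Finset.sdiff_subset)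
        fun p _ _ => sq_nonneg _).trans (hD i)
    exact mul_le_mul h3 h4 (Finset.sum_nonneg fun p _ => sq_nonneg _) hε.le
  have h0 : a ^ 2 ≤ 0 := by
    refine le_of_forall_pos_le_add fun ε hε => ?_
    have h := key (ε / (D + 1)) (by positivity)
    have h' : ε / (D + 1) * D ≤ ε := by
      rw [div_mul_eq_mul_div, div_le_iff₀ (by positivity)]
      nlinarith
    linarith
  exact pow_eq_zero_iff two_ne_zero |>.1 (le_antisymm h0 (sq_nonneg a))

open Classical in
/-- The indicator of a set with finite edge boundary has bounded energy. -/
theorem exists_energy_bound_indicator {V : Type*} {G : SimpleGraph V}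
    (hlf : ∀ v : V, (G.neighborSet v).Finite) (K : Finset V) {A : Set V}
    (hAmax : ∀ x ∈ A, ∀ y : V, y ∉ K → G.Adj x y → y ∈ A) :
    ∃ D : ℝ, ∀ T : Finset V, ∑ x ∈ T, ∑ y ∈ T,
      (if G.Adj x y then (1 : ℝ) else 0) *
        (A.indicator (fun _ => (1 : ℝ)) x - A.indicator (fun _ => (1 : ℝ)) y) ^ 2 ≤ D := by
  set Q : Finset (V × V) := (K.biUnion fun k => {k} ×ˢ (hlf k).toFinset) ∪
    K.biUnion fun k => (hlf k).toFinset ×ˢ {k} with hQ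
  set w : V × V → ℝ := fun p => (if G.Adj p.1 p.2 then (1 : ℝ) else 0) *
        (A.indicator (fun _ => (1 : ℝ)) p.1 - A.indicator (fun _ => (1 : ℝ)) p.2) ^ 2 with hw
  have hw0 : ∀ p, 0 ≤ w p := fun p => by simp only [hw]; positivity
  have hwQ : ∀ p, p ∉ Q → w p = 0 := by
    rintro ⟨x, y⟩ hp
    simp only [hw]
    by_cases hadj : G.Adj x y
    swap
    · simp [hadj]
    have hx : x ∉ K := fun hx => hp (Finset.mem_union_left _
      (Finset.mem_biUnion.2 ⟨x, hx, by simpa using hadj⟩))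
    have hy : y ∉ K := fun hy => hp (Finset.mem_union_right _
      (Finset.mem_biUnion.2 ⟨y, hy, by simpa using hadj.symm⟩))
    have hiff : x ∈ A ↔ y ∈ A :=
      ⟨fun h => hAmax x h y hy hadj, fun h => hAmax y h x hx hadj.symm⟩
    by_cases h : x ∈ A
    · simp [h, hiff.1 h]
    · simp [h, mt hiff.2 h]
  refine ⟨∑ p ∈ Q, w p, fun T => ?_⟩
  rw [← Finset.sum_product' T T fun x y => w (x, y)]
  refine (Finset.sum_le_sum_of_subset_of_nonneg (Finset.subset_union_left (s₂ := Q))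
    fun p _ _ => hw0 p).trans_eq ?_
  exact (Finset.sum_subset Finset.subset_union_right fun p _ hp => hwQ p hp).symm

/-- Let `G` be a connected, locally finite, infinite graph and `K` a finite set of
vertices such that `G − K` has (at least) two disjoint connected components `A`, `B`,
each transient for simple random walk.  Then `G` admits a nonconstant bounded harmonic
Dirichlet function. -/
theorem nonconstant_bounded_harmonic_dirichlet_of_two_transient_components
    {V : Type*} [Infinite V] (G : SimpleGraph V) (hconn : G.Connected)
    (hlf : ∀ v : V, (G.neighborSet v).Finite)
    (K : Finset V) (A B : Set V)
    (hAK : ∀ x ∈ A, x ∉ K) (hBK : ∀ x ∈ B, x ∉ K)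
    (hdisj : Disjoint A B) (hAne : A.Nonempty) (hBne : B.Nonempty)
    (hAconn : (G.induce A).Connected) (hBconn : (G.induce B).Connected)
    (hAmax : ∀ x ∈ A, ∀ y : V, y ∉ K → G.Adj x y → y ∈ A)
    (hBmax : ∀ x ∈ B, ∀ y : V, y ∉ K → G.Adj x y → y ∈ B)
    (hAtrans : IsTransient (G.induce A)) (hBtrans : IsTransient (G.induce B)) :
    ∃ F : V → ℝ, IsHarmonic G F ∧ (∃ M : ℝ, ∀ x, |F x| ≤ M) ∧ IsDirichlet G F ∧
      ∃ x y : V, F x ≠ F y := by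
  classical
  let N : V → Finset V := fun v => (hlf v).toFinset
  have hN : ∀ x y, y ∈ N x ↔ G.Adj x y := fun x y => by simp [N]
  let c : V → V → ℝ := fun x y => if G.Adj x y then 1 else 0
  have hc : ∀ x y, c x y = c y x := fun x y => by simp only [c, G.adj_comm]
  have hc0 : ∀ x y, 0 ≤ c x y := fun x y => by simp only [c]; positivity
  have hcd : ∀ x, c x x = 0 := fun x => by simp [c]
  let u : V → ℝ := A.indicator fun _ => 1
  have hu : ∀ x, u x ∈ Set.Icc (0 : ℝ) 1 := fun x => by
    by_cases h : x ∈ A <;> simp [u, h]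
  obtain ⟨D, hD⟩ := exists_energy_bound_indicator hlf K hAmax
  let T : Finset V → Finset V := fun S => S ∪ S.biUnion N
  have hST : ∀ S, S ⊆ T S := fun S => Finset.subset_union_left
  have hNT : ∀ S, ∀ x ∈ S, N x ⊆ T S := fun S x hx =>
    (Finset.subset_biUnion_of_mem N hx).trans Finset.subset_union_right
  choose f hf hfS hmin using fun S => exists_energy_minimizer c S (T S) u hu
  have hlap : ∀ S, ∀ z ∈ S, ∑ y ∈ N z, (f S z - f S y) = 0 := by
    intro S z hz
    have h := laplacian_eq_zero_of_minimal c hc hc0 hcd (T S) (f S) (hf S) z (hST S hz) ?_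
    · rw [← h, ← Finset.sum_subset (hNT S z hz)]
      · exact Finset.sum_congr rfl fun y hy => by simp [c, (hN z y).1 hy]
      · intro y _ hy
        simp [c, mt (hN z y).2 hy]
    · intro a ha
      refine hmin S _ (fun x => ?_) fun x hx => ?_
      · by_cases h : x = z
        · subst h; simpa using ha
        · simpa [h] using hf S x
      · rw [Function.update_of_ne (fun h : x = z => hx (h ▸ hz)), hfS S x hx]
  have henergy : ∀ S, ∑ p ∈ T S ×ˢ T S, c p.1 p.2 * (f S p.1 - f S p.2) ^ 2 ≤ D := by
    intro S
    rw [Finset.sum_product]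
    exact (hmin S u hu fun _ _ => rfl).trans (hD (T S))
  -- extract a pointwise limit along an ultrafilter
  let 𝓤 : Ultrafilter (Finset V) := Ultrafilter.of Filter.atTop
  have h𝓤 : (𝓤 : Filter (Finset V)) ≤ Filter.atTop := Ultrafilter.of_le Filter.atTop
  have hlim : ∀ x, ∃ a ∈ Set.Icc (0 : ℝ) 1, Filter.Tendsto (fun S => f S x) 𝓤 (nhds a) := fun x =>
    isCompact_Icc.ultrafilter_le_nhds (𝓤.map fun S => f S x)
      (Filter.le_principal_iff.2 (Filter.mem_map.2
        (Filter.univ_mem' fun S => hf S x)))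
  choose F hF hFlim using hlim
  have hev : ∀ S₀ : Finset V, ∀ᶠ S in (𝓤 : Filter (Finset V)), S₀ ⊆ S := fun S₀ =>
    h𝓤 (Filter.eventually_ge_atTop S₀)
  have hevP : ∀ E : Finset (V × V), ∀ᶠ S in (𝓤 : Filter (Finset V)), E ⊆ T S ×ˢ T S := by
    intro E
    filter_upwards [hev (E.image Prod.fst ∪ E.image Prod.snd)] with S hS p hp
    exact Finset.mem_product.2
      ⟨hST S (hS (Finset.mem_union_left _ (Finset.mem_image_of_mem _ hp))),
        hST S (hS (Finset.mem_union_right _ (Finset.mem_image_of_mem _ hp)))⟩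
  have hconst : ∀ C : Set V, IsTransient (G.induce C) →
      (∀ x ∈ C, ∀ y ∈ C, u x = u y) → (∀ x y, F x = F y) → ∃ o ∈ C, F o = u o := by
    intro C hC huC hFc
    obtain ⟨o, ho, θ, hanti, hsupp, hdiv, hsum⟩ := hC.exists_flow_of_induce hlf
    refine ⟨o, ho, ?_⟩
    have hpair : ∀ S, ∑ p ∈ T S ×ˢ T S, θ p.1 p.2 * (f S p.1 - f S p.2) =
        2 * (f S o - u o) := by
      intro S
      have h1 := sum_antisymm_mul_sub θ hanti (T S) fun x => f S x - u x
      have h2 : ∑ x ∈ T S, (f S x - u x) * ∑ y ∈ T S, θ x y = f S o - u o := by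
        have h3 : ∀ x, (f S x - u x) * ∑ y ∈ T S, θ x y =
            if x = o then f S o - u o else 0 := by
          intro x
          by_cases hx : x ∈ S
          · rw [← Finset.sum_subset (hNT S x hx) fun y _ hy => ?_, hdiv x]
            · split_ifs with hxo
              · rw [hxo, mul_one]
              · rw [mul_zero]
            · by_contra hne
              exact hy ((hN x y).2 (hsupp x y hne).1)
          · rw [hfS S x hx, sub_self, zero_mul]
            split_ifs with hxo
            · rw [← hxo, hfS S x hx, sub_self]
            · rfl
        rw [Finset.sum_congr rfl fun x _ => h3 x, Finset.sum_ite_eq']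
        split_ifs with h
        · rfl
        · rw [hfS S o fun h' => h (hST S h'), sub_self]
      rw [h2] at h1
      rw [Finset.sum_product, ← h1]
      refine Finset.sum_congr rfl fun x _ => Finset.sum_congr rfl fun y _ => ?_
      by_cases h : θ x y = 0
      · simp [h]
      · have h' := hsupp x y h
        rw [huC x h'.2.1 y h'.2.2]
        ring
    have h0 := pairing_limit_eq_zero (l := (𝓤 : Filter (Finset V)))
      (fun S => T S ×ˢ T S) hevP (fun p => θ p.1 p.2) hsum
      (fun S p => f S p.1 - f S p.2)
      (fun p => by simpa [hFc p.1 p.2] using (hFlim p.1).sub (hFlim p.2)) D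
      (fun S => by
        refine le_trans ?_ (henergy S)
        rw [Finset.sum_filter]
        refine Finset.sum_le_sum fun p _ => ?_
        split_ifs with h
        · simp [c, (hsupp _ _ h).1]
        · exact mul_nonneg (hc0 _ _) (sq_nonneg _))
      (2 * (F o - u o)) (by
        simp only [hpair]
        exact ((hFlim o).sub_const (u o)).const_mul 2)
    linarith
  refine ⟨F, ?_, ⟨1, fun x => abs_le.2 ⟨by linarith [(hF x).1], (hF x).2⟩⟩, ?_, ?_⟩
  · intro x
    have h1 : Filter.Tendsto (fun S => ∑ y ∈ N x, (f S x - f S y)) 𝓤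
        (nhds (∑ y ∈ N x, (F x - F y))) :=
      tendsto_finsetSum _ fun y _ => (hFlim x).sub (hFlim y)
    have h2 : Filter.Tendsto (fun S => ∑ y ∈ N x, (f S x - f S y)) 𝓤 (nhds 0) := by
      refine tendsto_const_nhds.congr' ?_
      filter_upwards [hev {x}] with S hS
      exact (hlap S x (hS (Finset.mem_singleton_self x))).symm
    have h3 := tendsto_nhds_unique h1 h2
    rw [Finset.sum_sub_distrib, Finset.sum_const, nsmul_eq_mul, sub_eq_zero] at h3
    have h4 : ∑' y : G.neighborSet x, F (y : V) = ∑ y ∈ N x, F y := by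
      rw [← Finset.tsum_subtype (N x) F]
      exact tsum_congr_set_coe F (by ext y; simp [N])
    rw [h4, ← h3, Set.ncard_eq_toFinset_card _ (hlf x)]
  · have hs : Summable fun p : V × V => c p.1 p.2 * (F p.1 - F p.2) ^ 2 := by
      refine summable_of_sum_le (c := D)
        (fun p => mul_nonneg (hc0 _ _) (sq_nonneg _)) fun E => ?_
      have h1 : Filter.Tendsto (fun S => ∑ p ∈ E, c p.1 p.2 * (f S p.1 - f S p.2) ^ 2) 𝓤
          (nhds (∑ p ∈ E, c p.1 p.2 * (F p.1 - F p.2) ^ 2)) :=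
        tendsto_finsetSum _ fun p _ =>
          (((hFlim p.1).sub (hFlim p.2)).pow 2).const_mul _
      refine le_of_tendsto h1 ?_
      filter_upwards [hevP E] with S hS
      exact (Finset.sum_le_sum_of_subset_of_nonneg hS fun p _ _ =>
        mul_nonneg (hc0 _ _) (sq_nonneg _)).trans (henergy S)
    refine (hs.comp_injective (Subtype.val_injective (p := fun p : V × V => G.Adj p.1 p.2))).congr
      fun p => ?_
    simp [c, p.2]
  · by_contra! hFc
    obtain ⟨a, haA, ha⟩ := hconst A hAtrans (fun x hx y hy => by simp [u, hx, hy]) hFc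
    have hBA : ∀ x ∈ B, x ∉ A := fun x hx hxA => Set.disjoint_left.1 hdisj hxA hx
    obtain ⟨b, hbB, hb⟩ := hconst B hBtrans
      (fun x hx y hy => by simp [u, hBA x hx, hBA y hy]) hFc
    have h := hFc a b
    rw [ha, hb] at h
    simp [u, haA, hBA b hbB] at h
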